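/- The series ∑_{l=0}^∞ (2l+1)²/(1 + l(l+1) + l²(l+1)²) converges and its sum is strictly less than π²/3 + 2. -/

import Mathlib

open Real

theorem hasSum_one_div_sub_one_div_succ :
    HasSum (fun n : ℕ => 1 / ((n : ℝ) + 1) - 1 / ((n : ℝ) + 2)) 1 := by
  rw [hasSum_iff_tendsto_nat_of_nonneg fun n => sub_nonneg.2 (by gcongr; norm_num)]
  have key (N : ℕ) : ∑ n ∈ Finset.range N, (1 / ((n : ℝ) + 1) - 1 / ((n : ℝ) + 2)) =
      1 - 1 / ((N : ℝ) + 1) := by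
    convert Finset.sum_range_sub' (fun n : ℕ => 1 / ((n : ℝ) + 1)) N using 2
    · push_cast
      ring
    · norm_num
  simp only [key]
  simpa using (tendsto_one_div_add_atTop_nhds_zero_nat (𝕜 := ℝ)).const_sub 1

theorem hasSum_sq_one_div_add_one_div_succ :
    HasSum (fun n : ℕ => (1 / ((n : ℝ) + 1) + 1 / ((n : ℝ) + 2)) ^ 2) (π ^ 2 / 3 + 1) := by
  have h₁ := (hasSum_nat_add_iff' 1).2 hasSum_zeta_two
  have h₂ := (hasSum_nat_add_iff' 2).2 hasSum_zeta_two
  convert! (h₁.add h₂).add (hasSum_one_div_sub_one_div_succ.mul_left 2) using 1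
  · ext n
    push_cast
    field_simp
    ring
  · norm_num [Finset.sum_range_succ]
    ring

theorem sq_div_lt_sq_one_div_add_one_div {x : ℝ} (hx : 0 < x) :
    (2 * x + 1) ^ 2 / (1 + x * (x + 1) + x ^ 2 * (x + 1) ^ 2) <
      (1 / x + 1 / (x + 1)) ^ 2 := by
  have h : (1 / x + 1 / (x + 1)) ^ 2 = (2 * x + 1) ^ 2 / (x ^ 2 * (x + 1) ^ 2) := by
    field_simp
    ring
  rw [h]
  gcongr
  linarith [mul_pos hx (by linarith : 0 < x + 1)]

/-- The series `∑_{l=0}^∞ (2l+1)²/(1 + l(l+1) + l²(l+1)²)` converges and its sum is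
strictly less than `π²/3 + 2`. -/
theorem stmt6 :
    Summable (fun l : ℕ =>
      ((2 * (l : ℝ) + 1) ^ 2) / (1 + l * (l + 1) + (l : ℝ) ^ 2 * ((l : ℝ) + 1) ^ 2)) ∧
    ∑' l : ℕ, ((2 * (l : ℝ) + 1) ^ 2) / (1 + l * (l + 1) + (l : ℝ) ^ 2 * ((l : ℝ) + 1) ^ 2)
      < π ^ 2 / 3 + 2 := by
  set f : ℕ → ℝ := fun l =>
    ((2 * (l : ℝ) + 1) ^ 2) / (1 + l * (l + 1) + (l : ℝ) ^ 2 * ((l : ℝ) + 1) ^ 2)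
  have hlt (n : ℕ) : f (n + 1) < (1 / ((n : ℝ) + 1) + 1 / ((n : ℝ) + 2)) ^ 2 := by
    have h := sq_div_lt_sq_one_div_add_one_div (x := ((n + 1 : ℕ) : ℝ)) (by positivity)
    convert! h using 4 <;> push_cast <;> ring
  have hg := hasSum_sq_one_div_add_one_div_succ
  have hs : Summable fun n => f (n + 1) :=
    hg.summable.of_nonneg_of_le (fun n => by positivity) fun n => (hlt n).le
  have hf : Summable f := (summable_nat_add_iff 1).1 hs
  refine ⟨hf, ?_⟩
  have h0 : f 0 = 1 := by simp [f]
  have htail : ∑' n, f (n + 1) < π ^ 2 / 3 + 1 :=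
    hasSum_lt (fun n => (hlt n).le) (hlt 0) hs.hasSum hg
  rw [hf.tsum_eq_zero_add, h0]
  linarith
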